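/- Let x ∈ F be a cut point of a connected GSC F and suppose F \ {x} has exactly two vertical connected components 𝒞₁ and 𝒞₂, with 𝒞₁ lying to the left of 𝒞₂. Then F ∩ ({0}×[0,1]) = 𝒞₁ ∩ ({0}×[0,1]) and F ∩ ({1}×[0,1]) = 𝒞₂ ∩ ({1}×[0,1]). In particular x ∉ {0,1}×[0,1]. -/

import Mathlib

open Set

/-- The map φ_d(x) = (x + d)/N on ℝ². -/
noncomputable def phi (N : ℕ) (d : ℕ × ℕ) (x : ℝ × ℝ) : ℝ × ℝ :=
  ((x.1 + d.1) / N, (x.2 + d.2) / N)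

/-- A set C ⊆ [0,1]² is vertical if it meets both [0,1]×{0} and [0,1]×{1}. -/
def IsVertical (C : Set (ℝ × ℝ)) : Prop :=
  (C ∩ {p | p.2 = 0 ∧ p.1 ∈ Icc (0 : ℝ) 1}).Nonempty ∧
  (C ∩ {p | p.2 = 1 ∧ p.1 ∈ Icc (0 : ℝ) 1}).Nonempty

open scoped Topology

section Crossing

/-- A preconnected subset of a convex set can be followed by paths staying inside the convex set
and arbitrarily close to the subset. -/
lemma IsPreconnected.joinedIn_thickening_inter {E : Type*} [NormedAddCommGroup E]
    [NormedSpace ℝ E] {K Q : Set E} (hK : IsPreconnected K) (hQ : Convex ℝ Q) (hKQ : K ⊆ Q)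
    {δ : ℝ} (hδ : 0 < δ) {p q : E} (hp : p ∈ K) (hq : q ∈ K) :
    JoinedIn (Metric.thickening δ K ∩ Q) p q := by
  refine hK.induction₂ (fun a b => JoinedIn (Metric.thickening δ K ∩ Q) a b) ?_
    (fun _ _ _ _ _ _ h h' => h.trans h') (fun _ _ _ _ h => h.symm) hp hq
  intro a ha
  filter_upwards [self_mem_nhdsWithin, mem_nhdsWithin_of_mem_nhds (Metric.ball_mem_nhds a hδ)]
    with b hb hab
  refine JoinedIn.of_segment_subset (subset_inter ?_ (hQ.segment_subset (hKQ ha) (hKQ hb)))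
  exact ((convex_ball a δ).segment_subset (Metric.mem_ball_self hδ) hab).trans
    (Metric.ball_subset_thickening ha δ)

/-- A continuous angle whose sine stays nonnegative cannot leave `[0, π]`. -/
lemma mem_Icc_of_sin_nonneg {h : ℝ → ℝ} (hc : Continuous h) (hs : ∀ t, 0 ≤ Real.sin (h t))
    {t₀ : ℝ} (h₀ : h t₀ ∈ Icc 0 Real.pi) (t : ℝ) : h t ∈ Icc 0 Real.pi := by
  have hpi := Real.pi_pos
  obtain ⟨h₁, h₂⟩ := h₀
  constructor
  · by_contra! hlt
    obtain ⟨r, hr⟩ := mem_range_of_exists_le_of_exists_ge hc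
      (c := max (h t) (-(Real.pi / 2))) ⟨t, le_max_left _ _⟩
      ⟨t₀, (max_le hlt.le (by linarith)).trans h₁⟩
    refine (hs r).not_gt (hr ▸ Real.sin_neg_of_neg_of_neg_pi_lt (max_lt hlt (by linarith)) ?_)
    exact lt_max_of_lt_right (by linarith)
  · by_contra! hlt
    obtain ⟨r, hr⟩ := mem_range_of_exists_le_of_exists_ge hc
      (c := min (h t) (3 * Real.pi / 2)) ⟨t₀, h₂.trans (le_min hlt.le (by linarith))⟩
      ⟨t, min_le_left _ _⟩
    have hneg : 0 < Real.sin (h r - Real.pi) := by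
      rw [hr]
      refine Real.sin_pos_of_pos_of_lt_pi ?_ ?_
      · linarith [lt_min hlt (show Real.pi < 3 * Real.pi / 2 by linarith)]
      · linarith [min_le_right (h t) (3 * Real.pi / 2)]
    rw [Real.sin_sub_pi] at hneg
    linarith [hs r]

/-- A nowhere vanishing continuous function on the plane has a continuous argument, normalised to
vanish at a point where the function is a positive real. -/
lemma exists_continuous_arg {f : ℝ × ℝ → ℂ} (hf : Continuous f) (h0 : ∀ z, f z ≠ 0)
    {z₀ : ℝ × ℝ} (hre : 0 < (f z₀).re) (him : (f z₀).im = 0) :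
    ∃ θ : ℝ × ℝ → ℝ, Continuous θ ∧ θ z₀ = 0 ∧
      ∀ z, ∃ r > 0, (f z).re = r * Real.cos (θ z) ∧ (f z).im = r * Real.sin (θ z) := by
  obtain ⟨g, ⟨hg0, hg⟩, -⟩ := Complex.isCoveringMapOn_exp.existsUnique_continuousMap_lifts
    ⟨f, hf⟩ (a₀ := z₀) (e₀ := Complex.log (f z₀)) (Complex.exp_log (h0 z₀)) (fun z => h0 z)
  refine ⟨fun z => (g z).im, by fun_prop, ?_, fun z => ⟨Real.exp (g z).re, Real.exp_pos _, ?_⟩⟩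
  · beta_reduce
    rw [hg0, Complex.log_im, Complex.arg_eq_zero_iff]
    exact ⟨hre.le, him⟩
  · have hz : Complex.exp (g z) = f z := congrFun hg z
    rw [← hz]
    exact ⟨Complex.exp_re _, Complex.exp_im _⟩

/-- Two curves in the unit square, one joining the bottom to the top, the other one joining the
left side to a point of the top lying to the right of the end of the first one, must meet. -/
lemma exists_eq_of_curves {α β : ℝ → ℝ × ℝ} (hα : Continuous α) (hβ : Continuous β)
    (hαQ : ∀ s, α s ∈ Icc (0 : ℝ × ℝ) 1) (hβQ : ∀ t, β t ∈ Icc (0 : ℝ × ℝ) 1)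
    (hα0 : (α 0).2 = 0) (hα1 : (α 1).2 = 1) (hβ0 : (β 0).1 = 0) (hβ1 : (β 1).2 = 1)
    (hlt : (α 1).1 < (β 1).1) : ∃ s t, α s = β t := by
  by_contra! hne
  have hpi := Real.pi_pos
  let f : ℝ × ℝ → ℂ := fun z => ⟨(β z.2).1 - (α z.1).1, (β z.2).2 - (α z.1).2⟩
  have hf : Continuous f := by
    have : f = fun z => (((β z.2).1 - (α z.1).1 : ℝ) : ℂ) +
        (((β z.2).2 - (α z.1).2 : ℝ) : ℂ) * Complex.I := by
      funext z
      apply Complex.ext <;> simp [f]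
    rw [this]
    fun_prop
  have h0 : ∀ z, f z ≠ 0 := fun z hz => by
    have h₁ := congrArg Complex.re hz
    have h₂ := congrArg Complex.im hz
    simp only [f, Complex.zero_re, Complex.zero_im] at h₁ h₂
    exact hne z.1 z.2 (Prod.ext (by linarith) (by linarith))
  obtain ⟨θ, hθ, hθ0, hθf⟩ := exists_continuous_arg (z₀ := (1, 1)) hf h0
    (by simpa [f] using hlt) (by simp [f, hα1, hβ1])
  have hsin : ∀ z, 0 ≤ (f z).im → 0 ≤ Real.sin (θ z) := fun z hz => by
    obtain ⟨r, hr, -, h⟩ := hθf z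
    exact nonneg_of_mul_nonneg_right (h ▸ hz) hr
  have hsin' : ∀ z, (f z).im ≤ 0 → Real.sin (θ z) ≤ 0 := fun z hz => by
    obtain ⟨r, hr, -, h⟩ := hθf z
    by_contra! hpos
    have := mul_pos hr hpos
    linarith
  have hcos : ∀ s, Real.cos (θ (s, 0)) ≤ 0 := fun s => by
    obtain ⟨r, hr, h, -⟩ := hθf (s, 0)
    by_contra! hpos
    have := mul_pos hr hpos
    have h' : 0 ≤ (α s).1 := (hαQ s).1.1
    simp only [f, hβ0] at h
    linarith
  have htop : ∀ s, θ (s, 1) ∈ Icc 0 Real.pi := by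
    refine mem_Icc_of_sin_nonneg (by fun_prop) (fun s => hsin _ ?_) (t₀ := 1) ?_
    · have h' : (α s).2 ≤ 1 := (hαQ s).2.2
      simpa [f, hβ1] using h'
    · simp [hθ0, hpi.le]
  have hbot : θ (0, 0) ∈ Icc 0 Real.pi := by
    refine mem_Icc_of_sin_nonneg (h := fun t => θ (0, t)) (by fun_prop) (fun t => hsin _ ?_)
      (htop 0) 0
    have h' : 0 ≤ (β t).2 := (hβQ t).1.2
    simpa [f, hα0] using h'
  have hleft : -θ (1, 0) ∈ Icc 0 Real.pi := by
    refine mem_Icc_of_sin_nonneg (h := fun t => -θ (1, t)) (by fun_prop) (fun t => ?_)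
      (t₀ := 1) (by simp [hθ0, hpi.le]) 0
    have h' : (β t).2 ≤ 1 := (hβQ t).2.2
    have := hsin' (1, t) (by simpa [f, hα1] using h')
    rw [Real.sin_neg]
    linarith
  obtain ⟨s, hs⟩ := mem_range_of_exists_le_of_exists_ge
    (f := fun s => θ (s, 0)) (c := 0) (by fun_prop) ⟨1, by linarith [hleft.1]⟩ ⟨0, hbot.1⟩
  have := hcos s
  simp only at hs
  rw [hs, Real.cos_zero] at this
  linarith

/-- Two continua in the unit square, one joining the bottom to the top, the other one joining the
left side to a point of the top lying to the right of the first one, must meet. -/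
lemma not_disjoint_of_crossing_left {K L : Set (ℝ × ℝ)} (hK : IsCompact K)
    (hKc : IsPreconnected K) (hL : IsCompact L) (hLc : IsPreconnected L)
    (hKQ : K ⊆ Icc 0 1) (hLQ : L ⊆ Icc 0 1) {p₀ p₁ q₀ q₁ : ℝ × ℝ}
    (hp₀ : p₀ ∈ K) (hp₁ : p₁ ∈ K) (hq₀ : q₀ ∈ L) (hq₁ : q₁ ∈ L)
    (h₀ : p₀.2 = 0) (h₁ : p₁.2 = 1) (h₂ : q₀.1 = 0) (h₃ : q₁.2 = 1) (hlt : p₁.1 < q₁.1) :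
    ¬ Disjoint K L := by
  intro hdisj
  obtain ⟨δ, hδ, hd⟩ := hdisj.exists_thickenings hK hL.isClosed
  obtain ⟨α, hα⟩ := hKc.joinedIn_thickening_inter (convex_Icc 0 1) hKQ hδ hp₀ hp₁
  obtain ⟨β, hβ⟩ := hLc.joinedIn_thickening_inter (convex_Icc 0 1) hLQ hδ hq₀ hq₁
  obtain ⟨s, t, hst⟩ := exists_eq_of_curves α.continuous_extend β.continuous_extend
    (fun s => (hα (projIcc 0 1 zero_le_one s)).2) (fun t => (hβ (projIcc 0 1 zero_le_one t)).2)
    (by simpa using h₀) (by simpa using h₁) (by simpa using h₂) (by simpa using h₃)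
    (by simpa using hlt)
  exact disjoint_left.1 hd (hα (projIcc 0 1 zero_le_one s)).1
    (by
      have h := (hβ (projIcc 0 1 zero_le_one t)).1
      change β.extend t ∈ _ at h
      rw [← hst] at h
      exact h)

/-- The mirror image of `not_disjoint_of_crossing_left`. -/
lemma not_disjoint_of_crossing_right {K L : Set (ℝ × ℝ)} (hK : IsCompact K)
    (hKc : IsPreconnected K) (hL : IsCompact L) (hLc : IsPreconnected L)
    (hKQ : K ⊆ Icc 0 1) (hLQ : L ⊆ Icc 0 1) {p₀ p₁ q₀ q₁ : ℝ × ℝ}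
    (hp₀ : p₀ ∈ K) (hp₁ : p₁ ∈ K) (hq₀ : q₀ ∈ L) (hq₁ : q₁ ∈ L)
    (h₀ : p₀.2 = 0) (h₁ : p₁.2 = 1) (h₂ : q₀.1 = 1) (h₃ : q₁.2 = 1) (hlt : q₁.1 < p₁.1) :
    ¬ Disjoint K L := by
  intro hdisj
  let σ : ℝ × ℝ → ℝ × ℝ := fun p => (1 - p.1, p.2)
  have hσ : Continuous σ := by fun_prop
  have hinj : Function.Injective σ := fun p q h => by
    simp only [σ, Prod.mk.injEq] at h
    exact Prod.ext (by linarith [h.1]) h.2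
  have hQ : ∀ {M : Set (ℝ × ℝ)}, M ⊆ Icc 0 1 → σ '' M ⊆ Icc 0 1 := by
    rintro M hM _ ⟨p, hp, rfl⟩
    obtain ⟨⟨h1, h2⟩, h3, h4⟩ := hM hp
    simp only [Prod.fst_zero, Prod.snd_zero, Prod.fst_one, Prod.snd_one] at h1 h2 h3 h4
    exact ⟨⟨by simpa [σ] using h3, h2⟩, ⟨by simpa [σ] using h1, h4⟩⟩
  refine not_disjoint_of_crossing_left (hK.image hσ) (hKc.image _ hσ.continuousOn)
    (hL.image hσ) (hLc.image _ hσ.continuousOn) (hQ hKQ) (hQ hLQ)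
    (mem_image_of_mem σ hp₀) (mem_image_of_mem σ hp₁) (mem_image_of_mem σ hq₀)
    (mem_image_of_mem σ hq₁) h₀ h₁ (by simp [σ, h₂]) h₃ (by simpa [σ] using hlt)
    ((disjoint_image_iff hinj).2 hdisj)

end Crossing

section SelfSimilar

lemma continuous_phi (N : ℕ) (d : ℕ × ℕ) : Continuous (phi N d) := by
  unfold phi
  fun_prop

lemma dist_phi {N : ℕ} (d : ℕ × ℕ) (p q : ℝ × ℝ) :
    dist (phi N d p) (phi N d q) = dist p q / N := by
  have h : ∀ a b c : ℝ, dist ((a + c) / N) ((b + c) / N) = dist a b / N := fun a b c => by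
    rw [Real.dist_eq, Real.dist_eq, ← sub_div, add_sub_add_right_eq_sub, abs_div, Nat.abs_cast]
  simp only [phi, Prod.dist_eq, h]
  exact max_div_div_right (Nat.cast_nonneg N) _ _

/-- A self-similar continuum is a finite union of arbitrarily small continua. -/
lemma exists_finite_cover_small_continua {N : ℕ} (hN : 2 ≤ N) {D : Finset (ℕ × ℕ)}
    {F : Set (ℝ × ℝ)} (hFc : IsCompact F) (hFattr : F = ⋃ d ∈ D, phi N d '' F)
    (hFconn : IsPreconnected F) (hFsub : F ⊆ Icc 0 1) (n : ℕ) :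
    ∃ S : Set (Set (ℝ × ℝ)), S.Finite ∧ ⋃₀ S = F ∧ ∀ K ∈ S, IsCompact K ∧ IsPreconnected K ∧
      ∀ p ∈ K, ∀ q ∈ K, dist p q ≤ (1 / 2) ^ n := by
  induction n with
  | zero =>
    refine ⟨{F}, finite_singleton F, sUnion_singleton F, ?_⟩
    rintro K rfl
    refine ⟨hFc, hFconn, fun p hp q hq => ?_⟩
    obtain ⟨⟨a, b⟩, c, d⟩ := hFsub hp
    obtain ⟨⟨a', b'⟩, c', d'⟩ := hFsub hq
    simp only [Prod.fst_zero, Prod.snd_zero, Prod.fst_one, Prod.snd_one] at a b c d a' b' c' d'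
    rw [pow_zero, Prod.dist_eq, Real.dist_eq, Real.dist_eq]
    exact max_le (abs_le.2 ⟨by linarith, by linarith⟩) (abs_le.2 ⟨by linarith, by linarith⟩)
  | succ n ih =>
    obtain ⟨S, hS, hSF, hSK⟩ := ih
    refine ⟨⋃ d ∈ D, (fun K => phi N d '' K) '' S,
      D.finite_toSet.biUnion fun d _ => hS.image _, ?_, ?_⟩
    · conv_rhs => rw [hFattr, ← hSF]
      simp only [sUnion_iUnion, sUnion_image, image_sUnion]
    · intro K hK
      simp only [mem_iUnion, mem_image] at hK
      obtain ⟨d, -, L, hL, rfl⟩ := hK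
      obtain ⟨hLc, hLp, hLd⟩ := hSK L hL
      refine ⟨hLc.image (continuous_phi N d), hLp.image _ (continuous_phi N d).continuousOn, ?_⟩
      rintro _ ⟨p, hp, rfl⟩ _ ⟨q, hq, rfl⟩
      have hN' : (2 : ℝ) ≤ N := by exact_mod_cast hN
      rw [dist_phi, pow_succ, mul_one_div]
      exact div_le_div₀ (by positivity) (hLd p hp q hq) two_pos hN'

/-- Every point of `F` has arbitrarily small neighbourhoods in `F` that are continua. -/
def HasSmallContinua {X : Type*} [TopologicalSpace X] (F : Set X) : Prop :=
  ∀ p ∈ F, ∀ U ∈ 𝓝 p, ∃ K ⊆ F ∩ U, IsCompact K ∧ IsPreconnected K ∧ p ∈ K ∧ K ∈ 𝓝[F] p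

lemma hasSmallContinua_of_selfSimilar {N : ℕ} (hN : 2 ≤ N) {D : Finset (ℕ × ℕ)}
    {F : Set (ℝ × ℝ)} (hFc : IsCompact F) (hFattr : F = ⋃ d ∈ D, phi N d '' F)
    (hFconn : IsPreconnected F) (hFsub : F ⊆ Icc 0 1) : HasSmallContinua F := by
  intro p hp U hU
  obtain ⟨ε, hε, hεU⟩ := Metric.mem_nhds_iff.1 hU
  obtain ⟨n, hn⟩ := exists_pow_lt_of_lt_one hε (show (1 / 2 : ℝ) < 1 by norm_num)
  obtain ⟨S, hS, hSF, hSK⟩ := exists_finite_cover_small_continua hN hFc hFattr hFconn hFsub n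
  have hfar : IsClosed (⋃₀ {K ∈ S | p ∉ K}) :=
    ((hS.subset (sep_subset _ _)).isCompact_sUnion fun K hK => (hSK K hK.1).1).isClosed
  refine ⟨⋃₀ {K ∈ S | p ∈ K}, ?_, ?_, ?_, ?_, ?_⟩
  · refine sUnion_subset fun K hK q hq => ⟨hSF ▸ mem_sUnion_of_mem hq hK.1, hεU ?_⟩
    exact ((hSK K hK.1).2.2 q hq p hK.2).trans_lt hn
  · exact (hS.subset (sep_subset _ _)).isCompact_sUnion fun K hK => (hSK K hK.1).1
  · exact isPreconnected_sUnion p _ (fun K hK => hK.2) fun K hK => (hSK K hK.1).2.1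
  · obtain ⟨K, hK, hpK⟩ := hSF.symm ▸ hp
    exact ⟨K, ⟨hK, hpK⟩, hpK⟩
  · have hmem : (⋃₀ {K ∈ S | p ∉ K})ᶜ ∈ 𝓝 p :=
      hfar.isOpen_compl.mem_nhds fun ⟨K, hK, hpK⟩ => hK.2 hpK
    filter_upwards [self_mem_nhdsWithin, mem_nhdsWithin_of_mem_nhds hmem] with q hq hq'
    obtain ⟨K, hK, hqK⟩ := hSF.symm ▸ hq
    exact ⟨K, ⟨hK, by_contra fun hpK => hq' ⟨K, ⟨hK, hpK⟩, hqK⟩⟩, hqK⟩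

end SelfSimilar

section Components

variable {X : Type*} [TopologicalSpace X] [T2Space X] {F : Set X} {x y : X}

lemma HasSmallContinua.exists_subset_component (hF : HasSmallContinua F) {p : X}
    (hp : p ∈ connectedComponentIn (F \ {x}) y) :
    ∃ K ⊆ connectedComponentIn (F \ {x}) y, IsCompact K ∧ IsPreconnected K ∧ p ∈ K ∧
      K ∈ 𝓝[F] p := by
  have hpF := connectedComponentIn_subset _ _ hp
  obtain ⟨K, hKF, hKc, hKp, hpK, hKn⟩ := hF p hpF.1 {x}ᶜ (isOpen_compl_singleton.mem_nhds hpF.2)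
  refine ⟨K, ?_, hKc, hKp, hpK, hKn⟩
  rw [connectedComponentIn_eq hp]
  exact hKp.subset_connectedComponentIn hpK hKF

lemma HasSmallContinua.isClosed_diff_component (hF : HasSmallContinua F) (hFc : IsClosed F) :
    IsClosed (F \ connectedComponentIn (F \ {x}) y) := by
  refine isClosed_of_closure_subset fun p hp => ⟨closure_minimal sdiff_subset hFc hp, fun hpC => ?_⟩
  obtain ⟨K, hKC, -, -, -, hKn⟩ := hF.exists_subset_component hpC
  obtain ⟨V, hV, hVK⟩ := mem_nhdsWithin_iff_exists_mem_nhds_inter.1 hKn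
  obtain ⟨q, hqV, hqF, hqC⟩ := mem_closure_iff_nhds.1 hp V hV
  exact hqC (hKC (hVK ⟨hqV, hqF⟩))

lemma HasSmallContinua.exists_continuum_subset_component (hF : HasSmallContinua F) {p q : X}
    (hp : p ∈ connectedComponentIn (F \ {x}) y) (hq : q ∈ connectedComponentIn (F \ {x}) y) :
    ∃ K ⊆ connectedComponentIn (F \ {x}) y, IsCompact K ∧ IsPreconnected K ∧ p ∈ K ∧ q ∈ K := by
  refine isPreconnected_connectedComponentIn.induction₂ (fun p q =>
    ∃ K ⊆ connectedComponentIn (F \ {x}) y, IsCompact K ∧ IsPreconnected K ∧ p ∈ K ∧ q ∈ K)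
    (fun a ha => ?_) ?_ ?_ hp hq
  · obtain ⟨K, hKC, hKc, hKp, haK, hKn⟩ := hF.exists_subset_component ha
    have hCF : connectedComponentIn (F \ {x}) y ⊆ F :=
      (connectedComponentIn_subset _ _).trans sdiff_subset
    filter_upwards [nhdsWithin_mono a hCF hKn] with b hb
    exact ⟨K, hKC, hKc, hKp, haK, hb⟩
  · rintro a b c - - - ⟨K, hK, hKc, hKp, haK, hbK⟩ ⟨L, hL, hLc, hLp, hbL, hcL⟩
    exact ⟨K ∪ L, union_subset hK hL, hKc.union hLc, hKp.union b hbK hbL hLp, .inl haK, .inr hcL⟩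
  · rintro a b - - ⟨K, hK, hKc, hKp, haK, hbK⟩
    exact ⟨K, hK, hKc, hKp, hbK, haK⟩

/-- Every component of `F \ {x}` accumulates at `x`. -/
lemma HasSmallContinua.mem_closure_component (hF : HasSmallContinua F) (hFc : IsClosed F)
    (hFconn : IsPreconnected F) (hx : x ∈ F) (hy : y ∈ F \ {x}) :
    x ∈ closure (connectedComponentIn (F \ {x}) y) := by
  by_contra hxC
  set C := connectedComponentIn (F \ {x}) y
  have hyC : y ∈ C := mem_connectedComponentIn hy
  have hCF : C ⊆ F := (connectedComponentIn_subset _ _).trans sdiff_subset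
  have hCcl : IsClosed C := by
    refine isClosed_of_closure_subset ?_
    refine isPreconnected_connectedComponentIn.closure.subset_connectedComponentIn
      (subset_closure hyC) fun p hp => ⟨closure_minimal hCF hFc hp, ?_⟩
    rintro rfl
    exact hxC hp
  obtain ⟨p, -, hpC, hpC'⟩ := isPreconnected_closed_iff.1 hFconn C (F \ C) hCcl
    (hF.isClosed_diff_component hFc) (by rw [union_sdiff_cancel hCF])
    ⟨y, hy.1, hyC⟩ ⟨x, hx, hx, fun h => hxC (subset_closure h)⟩
  exact hpC'.2 hpC

/-- Removing a component of `F \ {x}` from `F` leaves a set any two points of which lie on a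
common continuum. -/
lemma HasSmallContinua.exists_continuum_diff_component (hF : HasSmallContinua F)
    (hFc : IsCompact F) (hFconn : IsPreconnected F) (hx : x ∈ F) {p q : X}
    (hp : p ∈ F \ connectedComponentIn (F \ {x}) y)
    (hq : q ∈ F \ connectedComponentIn (F \ {x}) y) :
    ∃ K ⊆ F \ connectedComponentIn (F \ {x}) y,
      IsCompact K ∧ IsPreconnected K ∧ p ∈ K ∧ q ∈ K := by
  have key : ∀ r ∈ F \ connectedComponentIn (F \ {x}) y,
      ∃ K ⊆ F \ connectedComponentIn (F \ {x}) y,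
        IsCompact K ∧ IsPreconnected K ∧ r ∈ K ∧ x ∈ K := by
    intro r hr
    by_cases hrx : r = x
    · subst hrx
      exact ⟨{r}, singleton_subset_iff.2 hr, isCompact_singleton, isPreconnected_singleton,
        rfl, rfl⟩
    have hr' : r ∈ F \ {x} := ⟨hr.1, hrx⟩
    have hsub : closure (connectedComponentIn (F \ {x}) r) ⊆
        F \ connectedComponentIn (F \ {x}) y := by
      refine closure_minimal (fun s hs => ⟨(connectedComponentIn_subset _ _ hs).1, fun hs' => ?_⟩)
        (hF.isClosed_diff_component hFc.isClosed)
      apply hr.2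
      rw [connectedComponentIn_eq hs', ← connectedComponentIn_eq hs]
      exact mem_connectedComponentIn hr'
    exact ⟨_, hsub, hFc.of_isClosed_subset isClosed_closure (hsub.trans sdiff_subset),
      isPreconnected_connectedComponentIn.closure,
      subset_closure (mem_connectedComponentIn hr'),
      hF.mem_closure_component hFc.isClosed hFconn hx hr'⟩
  obtain ⟨K, hK, hKc, hKp, hpK, hxK⟩ := key p hp
  obtain ⟨L, hL, hLc, hLp, hqL, hxL⟩ := key q hq
  exact ⟨K ∪ L, union_subset hK hL, hKc.union hLc, hKp.union x hxK hxL hLp, .inl hpK, .inr hqL⟩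

end Components

/-- If x is a cut point of a connected GSC F whose complement F \ {x} has exactly
two vertical components 𝒞₁ (to the left) and 𝒞₂ (to the right), then
F ∩ ({0}×[0,1]) = 𝒞₁ ∩ ({0}×[0,1]) and F ∩ ({1}×[0,1]) = 𝒞₂ ∩ ({1}×[0,1]);
in particular x ∉ {0,1}×[0,1]. -/
theorem stmt8 (N : ℕ) (hN : 2 ≤ N) (D : Finset (ℕ × ℕ))
    (hD : ∀ d ∈ D, d.1 < N ∧ d.2 < N) (hDcard : 1 < D.card ∧ D.card < N ^ 2)
    (F : Set (ℝ × ℝ)) (hFne : F.Nonempty) (hFc : IsCompact F)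
    (hFattr : F = ⋃ d ∈ D, phi N d '' F) (hFconn : IsConnected F)
    (hFsub : F ⊆ Icc (0, 0) (1, 1))
    (x : ℝ × ℝ) (hx : x ∈ F) (hcut : ¬ IsPreconnected (F \ {x}))
    (C₁ C₂ : Set (ℝ × ℝ))
    (hC₁ : ∃ y ∈ F \ {x}, C₁ = connectedComponentIn (F \ {x}) y)
    (hC₂ : ∃ y ∈ F \ {x}, C₂ = connectedComponentIn (F \ {x}) y)
    (hV₁ : IsVertical C₁) (hV₂ : IsVertical C₂) (hne : C₁ ≠ C₂)
    (honlytwo : ∀ C : Set (ℝ × ℝ),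
      (∃ y ∈ F \ {x}, C = connectedComponentIn (F \ {x}) y) → IsVertical C →
        C = C₁ ∨ C = C₂)
    (hleft : ∀ p ∈ C₁, ∀ q ∈ C₂,
      p.2 ∈ ({0, 1} : Set ℝ) → q.2 ∈ ({0, 1} : Set ℝ) → p.1 ≤ q.1) :
    F ∩ {p | p.1 = 0 ∧ p.2 ∈ Icc (0 : ℝ) 1} =
        C₁ ∩ {p | p.1 = 0 ∧ p.2 ∈ Icc (0 : ℝ) 1} ∧
      F ∩ {p | p.1 = 1 ∧ p.2 ∈ Icc (0 : ℝ) 1} =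
        C₂ ∩ {p | p.1 = 1 ∧ p.2 ∈ Icc (0 : ℝ) 1} ∧
      x ∉ {p : ℝ × ℝ | (p.1 = 0 ∨ p.1 = 1) ∧ p.2 ∈ Icc (0 : ℝ) 1} := by
  have hlc : HasSmallContinua F :=
    hasSmallContinua_of_selfSimilar hN hFc hFattr hFconn.isPreconnected hFsub
  obtain ⟨y₁, hy₁, rfl⟩ := hC₁
  obtain ⟨y₂, hy₂, rfl⟩ := hC₂
  have hCF : ∀ y, connectedComponentIn (F \ {x}) y ⊆ F := fun y =>
    (connectedComponentIn_subset _ _).trans sdiff_subset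
  have hdisj : ∀ p ∈ connectedComponentIn (F \ {x}) y₁,
      p ∉ connectedComponentIn (F \ {x}) y₂ := fun p hp hp' =>
    hne ((connectedComponentIn_eq hp).trans (connectedComponentIn_eq hp').symm)
  obtain ⟨⟨a₀, ha₀, ha₀', -⟩, ⟨a₁, ha₁, ha₁', -⟩⟩ := hV₁
  obtain ⟨⟨b₀, hb₀, hb₀', -⟩, ⟨b₁, hb₁, hb₁', -⟩⟩ := hV₂
  have hlt : a₁.1 < b₁.1 := by
    refine lt_of_le_of_ne (hleft a₁ ha₁ b₁ hb₁ (.inr ha₁') (.inr hb₁')) fun h => ?_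
    exact hdisj a₁ ha₁ (Prod.ext h (ha₁'.trans hb₁'.symm) ▸ hb₁)
  have hL : ∀ p ∈ F, p.1 = 0 → p ∈ connectedComponentIn (F \ {x}) y₁ := by
    intro p hp hp0
    by_contra hpC
    obtain ⟨K, hK, hKc, hKp, h₀, h₁⟩ := hlc.exists_continuum_subset_component ha₀ ha₁
    obtain ⟨L, hL, hLc, hLp, h₂, h₃⟩ := hlc.exists_continuum_diff_component hFc
      hFconn.isPreconnected hx ⟨hp, hpC⟩ ⟨hCF _ hb₁, fun h => hdisj _ h hb₁⟩
    exact not_disjoint_of_crossing_left hKc hKp hLc hLp ((hK.trans (hCF _)).trans hFsub)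
      ((hL.trans sdiff_subset).trans hFsub) h₀ h₁ h₂ h₃ ha₀' ha₁' hp0 hb₁' hlt
      (disjoint_left.2 fun q hqK hqL => (hL hqL).2 (hK hqK))
  have hR : ∀ p ∈ F, p.1 = 1 → p ∈ connectedComponentIn (F \ {x}) y₂ := by
    intro p hp hp1
    by_contra hpC
    obtain ⟨K, hK, hKc, hKp, h₀, h₁⟩ := hlc.exists_continuum_subset_component hb₀ hb₁
    obtain ⟨L, hL, hLc, hLp, h₂, h₃⟩ := hlc.exists_continuum_diff_component hFc
      hFconn.isPreconnected hx ⟨hp, hpC⟩ ⟨hCF _ ha₁, hdisj _ ha₁⟩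
    exact not_disjoint_of_crossing_right hKc hKp hLc hLp ((hK.trans (hCF _)).trans hFsub)
      ((hL.trans sdiff_subset).trans hFsub) h₀ h₁ h₂ h₃ hb₀' hb₁' hp1 ha₁' hlt
      (disjoint_left.2 fun q hqK hqL => (hL hqL).2 (hK hqK))
  refine ⟨?_, ?_, ?_⟩
  · exact Subset.antisymm (fun p hp => ⟨hL p hp.1 hp.2.1, hp.2⟩)
      (inter_subset_inter_left _ (hCF _))
  · exact Subset.antisymm (fun p hp => ⟨hR p hp.1 hp.2.1, hp.2⟩)
      (inter_subset_inter_left _ (hCF _))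
  · rintro ⟨h | h, -⟩
    · exact (connectedComponentIn_subset _ _ (hL x hx h)).2 rfl
    · exact (connectedComponentIn_subset _ _ (hR x hx h)).2 rfl
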